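/- Let Ω ⊆ ℝ³ be a domain convex in the directions of the lines L₁ and L₂, and assume that at least one number in each of the pairs (a₁, b₁) and (a₂, b₂) lies in ℂ∖ℝ. Then every left-G-monogenic mapping Φ̂ : Ω_ζ → ℍ(ℂ) has the form Φ̂(ζ) = F₁(ξ₁)e₁ + F₂(ξ₂)e₂ + F₃(ξ₂)e₃ + F₄(ξ₁)e₄ for all ζ = x i₁ + y i₂ + z i₃ ∈ Ω_ζ, where F₁ and F₄ are analytic functions on D₁ of the variable ξ₁ = x + y a₁ + z b₁, and F₂ and F₃ are analytic functions on D₂ of the variable ξ₂ = x + y a₂ + z b₂. -/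

import Mathlib

open Filter Set Topology Quaternion

noncomputable section

abbrev HC : Type := ℍ[ℂ, -1, -1]

/-- The idempotent `e₁ = (1 + iI)/2`. -/
def e1 : HC := ⟨1/2, Complex.I/2, 0, 0⟩
/-- The idempotent `e₂ = (1 - iI)/2`. -/
def e2 : HC := ⟨1/2, -(Complex.I/2), 0, 0⟩
/-- `e₃ = (iJ - K)/2`. -/
def e3 : HC := ⟨0, 0, Complex.I/2, -(1/2)⟩
/-- `e₄ = (iJ + K)/2`. -/
def e4 : HC := ⟨0, 0, Complex.I/2, 1/2⟩

/-- Topology on `ℍ(ℂ)` induced from the four complex coordinates. -/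
instance : TopologicalSpace HC :=
  TopologicalSpace.induced (fun q : HC => (q.re, q.imI, q.imJ, q.imK)) inferInstance

/-- Coordinate of `a ∈ ℍ(ℂ)` at `e₁` in the basis `{e₁, e₂, e₃, e₄}`. -/
def c1 (a : HC) : ℂ := a.re - Complex.I * a.imI
/-- Coordinate at `e₂`. -/
def c2 (a : HC) : ℂ := a.re + Complex.I * a.imI
/-- Coordinate at `e₃`. -/
def c3 (a : HC) : ℂ := -(Complex.I * a.imJ) - a.imK
/-- Coordinate at `e₄`. -/
def c4 (a : HC) : ℂ := -(Complex.I * a.imJ) + a.imK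

/-- The norm `‖a‖ = √(|a₁|² + |a₂|² + |a₃|² + |a₄|²)`, coordinates in the basis `{e₁,e₂,e₃,e₄}`. -/
def qnorm (a : HC) : ℝ :=
  Real.sqrt (‖c1 a‖ ^ 2 + ‖c2 a‖ ^ 2 +
    ‖c3 a‖ ^ 2 + ‖c4 a‖ ^ 2)

/-- `f₁ : ℍ(ℂ) → ℂ`, the ℂ-linear functional with `f₁(e₁) = f₁(e₃) = 1`, `f₁(e₂) = f₁(e₄) = 0`. -/
def f1 (a : HC) : ℂ := c1 a + c3 a
/-- `f₂ : ℍ(ℂ) → ℂ`, with `f₂(e₂) = f₂(e₄) = 1`, `f₂(e₁) = f₂(e₃) = 0`. -/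
def f2 (a : HC) : ℂ := c2 a + c4 a
/-- `f̂₁ : ℍ(ℂ) → ℂ`, with `f̂₁(e₁) = f̂₁(e₄) = 1`, `f̂₁(e₂) = f̂₁(e₃) = 0`. -/
def fh1 (a : HC) : ℂ := c1 a + c4 a
/-- `f̂₂ : ℍ(ℂ) → ℂ`, with `f̂₂(e₂) = f̂₂(e₃) = 1`, `f̂₂(e₁) = f̂₂(e₄) = 0`. -/
def fh2 (a : HC) : ℂ := c2 a + c3 a

/-- `ζ = x i₁ + y i₂ + z i₃` for `p = (x, y, z) ∈ ℝ³` (with `i₁ = 1`). -/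
def zeta (i2 i3 : HC) (p : ℝ × ℝ × ℝ) : HC :=
  (p.1 : ℂ) • (1 : HC) + (p.2.1 : ℂ) • i2 + (p.2.2 : ℂ) • i3

/-- The real linear span `E₃` of `i₁ = 1, i₂, i₃`. -/
def E3 (i2 i3 : HC) : Set HC := Set.range (zeta i2 i3)

/-- `i₁ = 1, i₂, i₃` are linearly independent over `ℝ`. -/
def LinIndep (i2 i3 : HC) : Prop :=
  ∀ α₁ α₂ α₃ : ℝ, (α₁ : ℂ) • (1 : HC) + (α₂ : ℂ) • i2 + (α₃ : ℂ) • i3 = 0 →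
    α₁ = 0 ∧ α₂ = 0 ∧ α₃ = 0

/-- `Φ` is right-G-monogenic on `S` (w.r.t. directions in `E₃`): it is continuous on `S` and at
every `ζ ∈ S` there is `Φ'(ζ)` with `lim_{ε→0+} (Φ(ζ+εh) − Φ(ζ))ε⁻¹ = h·Φ'(ζ)` for all `h ∈ E₃`. -/
def RightGMonogenic (i2 i3 : HC) (Φ : HC → HC) (S : Set HC) : Prop :=
  ContinuousOn Φ S ∧ ∀ ζ ∈ S, ∃ Φ' : HC, ∀ h ∈ E3 i2 i3,
    Tendsto (fun ε : ℝ => ((ε : ℂ))⁻¹ • (Φ (ζ + (ε : ℂ) • h) - Φ ζ))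
      (nhdsWithin 0 (Set.Ioi 0)) (nhds (h * Φ'))

/-- `Φ̂` is left-G-monogenic on `S`. -/
def LeftGMonogenic (i2 i3 : HC) (Φ : HC → HC) (S : Set HC) : Prop :=
  ContinuousOn Φ S ∧ ∀ ζ ∈ S, ∃ Φ' : HC, ∀ h ∈ E3 i2 i3,
    Tendsto (fun ε : ℝ => ((ε : ℂ))⁻¹ • (Φ (ζ + (ε : ℂ) • h) - Φ ζ))
      (nhdsWithin 0 (Set.Ioi 0)) (nhds (Φ' * h))

/-- The right maximal ideal `𝓘₁ = {λ₂e₂ + λ₄e₄}`. -/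
def I1 : Set HC := {a | ∃ l2 l4 : ℂ, a = l2 • e2 + l4 • e4}
/-- The right maximal ideal `𝓘₂ = {λ₁e₁ + λ₃e₃}`. -/
def I2 : Set HC := {a | ∃ l1 l3 : ℂ, a = l1 • e1 + l3 • e3}
/-- The left maximal ideal `𝓘̂₁ = {λ₂e₂ + λ₃e₃}`. -/
def Ih1 : Set HC := {a | ∃ l2 l3 : ℂ, a = l2 • e2 + l3 • e3}
/-- The left maximal ideal `𝓘̂₂ = {λ₁e₁ + λ₄e₄}`. -/
def Ih2 : Set HC := {a | ∃ l1 l4 : ℂ, a = l1 • e1 + l4 • e4}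

/-- The line `L` in `ℝ³` given by `x + y·Re a + z·Re b = 0`, `y·Im a + z·Im b = 0`. -/
def lineL (a b : ℂ) : Set (ℝ × ℝ × ℝ) :=
  {p | p.1 + p.2.1 * a.re + p.2.2 * b.re = 0 ∧ p.2.1 * a.im + p.2.2 * b.im = 0}

/-- `Ω` is convex in the direction of the line `L` (a line through the origin): it contains every
segment parallel to `L` joining two of its points. -/
def ConvexInDirection (Ω : Set (ℝ × ℝ × ℝ)) (L : Set (ℝ × ℝ × ℝ)) : Prop :=
  ∀ p ∈ Ω, ∀ q ∈ Ω, q - p ∈ L → segment ℝ p q ⊆ Ω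

/-- `ξ = x + y·a + z·b` for `p = (x,y,z)`. -/
def xi (a b : ℂ) (p : ℝ × ℝ × ℝ) : ℂ := (p.1 : ℂ) + (p.2.1 : ℂ) * a + (p.2.2 : ℂ) * b


/-- `Φ'` is a right Gateaux derivative of `Φ` on `S` (directions in `E₃`). -/
def IsRightGDeriv (i2 i3 : HC) (Φ Φ' : HC → HC) (S : Set HC) : Prop :=
  ∀ ζ ∈ S, ∀ h ∈ E3 i2 i3,
    Tendsto (fun ε : ℝ => ((ε : ℂ))⁻¹ • (Φ (ζ + (ε : ℂ) • h) - Φ ζ))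
      (nhdsWithin 0 (Set.Ioi 0)) (nhds (h * Φ' ζ))

/-- `Φ'` is a left Gateaux derivative of `Φ` on `S`. -/
def IsLeftGDeriv (i2 i3 : HC) (Φ Φ' : HC → HC) (S : Set HC) : Prop :=
  ∀ ζ ∈ S, ∀ h ∈ E3 i2 i3,
    Tendsto (fun ε : ℝ => ((ε : ℂ))⁻¹ • (Φ (ζ + (ε : ℂ) • h) - Φ ζ))
      (nhdsWithin 0 (Set.Ioi 0)) (nhds (Φ' ζ * h))

/-- Triples `(α, β, γ)` of naturals with `α + β + γ = n`. -/
def trip (n : ℕ) : Finset (ℕ × ℕ × ℕ) :=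
  (Finset.range (n + 1) ×ˢ Finset.range (n + 1) ×ˢ Finset.range (n + 1)).filter
    (fun u => u.1 + u.2.1 + u.2.2 = n)

/-- Boundary integral over a rectangle. -/
def gmA (f : ℝ × ℝ → ℂ) (x0 x1 y0 y1 : ℝ) : ℂ :=
  (∫ x in x0..x1, f (x, y0)) - (∫ x in x0..x1, f (x, y1))
    + Complex.I * (∫ y in y0..y1, f (x1, y)) - Complex.I * (∫ y in y0..y1, f (x0, y))

lemma gm_int_x {f : ℝ × ℝ → ℂ} (hf : Continuous f) (y a b : ℝ) :
    IntervalIntegrable (fun x => f (x, y)) MeasureTheory.volume a b :=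
  Continuous.intervalIntegrable (by fun_prop) a b

lemma gm_int_y {f : ℝ × ℝ → ℂ} (hf : Continuous f) (x a b : ℝ) :
    IntervalIntegrable (fun y => f (x, y)) MeasureTheory.volume a b :=
  Continuous.intervalIntegrable (by fun_prop) a b

lemma gmA_add_x {f : ℝ × ℝ → ℂ} (hf : Continuous f) (x0 x1 x2 y0 y1 : ℝ) :
    gmA f x0 x2 y0 y1 = gmA f x0 x1 y0 y1 + gmA f x1 x2 y0 y1 := by
  unfold gmA
  rw [← intervalIntegral.integral_add_adjacent_intervals (gm_int_x hf y0 x0 x1)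
    (gm_int_x hf y0 x1 x2), ← intervalIntegral.integral_add_adjacent_intervals
    (gm_int_x hf y1 x0 x1) (gm_int_x hf y1 x1 x2)]
  ring

lemma gmA_add_y {f : ℝ × ℝ → ℂ} (hf : Continuous f) (x0 x1 y0 y1 y2 : ℝ) :
    gmA f x0 x1 y0 y2 = gmA f x0 x1 y0 y1 + gmA f x0 x1 y1 y2 := by
  unfold gmA
  rw [← intervalIntegral.integral_add_adjacent_intervals (gm_int_y hf x0 y0 y1)
    (gm_int_y hf x0 y1 y2), ← intervalIntegral.integral_add_adjacent_intervals
    (gm_int_y hf x1 y0 y1) (gm_int_y hf x1 y1 y2)]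
  ring

lemma gmA_self_x (f : ℝ × ℝ → ℂ) (x y0 y1 : ℝ) : gmA f x x y0 y1 = 0 := by
  simp [gmA]

lemma gmA_self_y (f : ℝ × ℝ → ℂ) (x0 x1 y : ℝ) : gmA f x0 x1 y y = 0 := by
  simp [gmA]

lemma gmA_cont {f : ℝ × ℝ → ℂ} (hf : Continuous f) (x0 x1 y0 y1 : ℝ) :
    Continuous (fun t : ℝ => gmA f (x0 + t) (x1 - t) (y0 + t) (y1 - t)) := by
  have key : ∀ (g : ℝ → ℝ → ℂ), Continuous (Function.uncurry g) → ∀ a b : ℝ → ℝ,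
      Continuous a → Continuous b → Continuous (fun t => ∫ x in a t..b t, g t x) := by
    intro g hg a b ha hb
    have h : (fun t => ∫ x in a t..b t, g t x) =
        fun t => (∫ x in (0:ℝ)..b t, g t x) - ∫ x in (0:ℝ)..a t, g t x := by
      funext t
      have hgt : Continuous (g t) := hg.comp (by fun_prop : Continuous fun x : ℝ => (t, x))
      rw [intervalIntegral.integral_interval_sub_left] <;> exact hgt.intervalIntegrable _ _
    rw [h]
    exact (intervalIntegral.continuous_parametric_intervalIntegral_of_continuous hg hb).sub
      (intervalIntegral.continuous_parametric_intervalIntegral_of_continuous hg ha)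
  unfold gmA
  refine (((key _ ?_ _ _ ?_ ?_).sub (key _ ?_ _ _ ?_ ?_)).add
    (continuous_const.mul (key _ ?_ _ _ ?_ ?_))).sub (continuous_const.mul (key _ ?_ _ _ ?_ ?_)) <;>
    fun_prop

/-- Boundary integral bound after subtracting a constant and a linear function. -/
lemma gmA_linear {f : ℝ × ℝ → ℂ} (hf : Continuous f) (x0 x1 y0 y1 : ℝ) (D C : ℂ) :
    gmA (fun p => f p - D * ((p.1 : ℂ) + Complex.I * p.2) - C) x0 x1 y0 y1
      = gmA f x0 x1 y0 y1 := by
  have e : ∀ (g h : ℝ → ℂ), Continuous g → Continuous h → ∀ a b : ℝ,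
      (∫ x in a..b, (g x - h x)) = (∫ x in a..b, g x) - ∫ x in a..b, h x := by
    intro g h hg hh a b
    exact intervalIntegral.integral_sub (hg.intervalIntegrable _ _) (hh.intervalIntegrable _ _)
  have e2 : ∀ (a b : ℝ) (D E : ℂ), (∫ x in a..b, D * ((x : ℂ) + E)) =
      D * (((b : ℂ) ^ 2 - a ^ 2) / 2 + (b - a) * E) := by
    intro a b D E
    rw [intervalIntegral.integral_const_mul, intervalIntegral.integral_add
      (Continuous.intervalIntegrable (by fun_prop) _ _) (by simp), intervalIntegral.integral_ofReal]
    simp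
  have e3 : ∀ (a b : ℝ) (D E : ℂ), (∫ x in a..b, D * (E + Complex.I * (x : ℂ))) =
      D * (Complex.I * ((b : ℂ) ^ 2 - a ^ 2) / 2 + (b - a) * E) := by
    intro a b D E
    rw [intervalIntegral.integral_const_mul, intervalIntegral.integral_add (by simp)
      (Continuous.intervalIntegrable (by fun_prop) _ _), intervalIntegral.integral_const_mul,
      intervalIntegral.integral_ofReal]
    simp only [intervalIntegral.integral_const, integral_id, Complex.real_smul]
    push_cast; ring
  unfold gmA
  simp only
  rw [e _ _ (by fun_prop) (by fun_prop), e _ _ (by fun_prop) (by fun_prop),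
   e _ _ (by fun_prop) (by fun_prop), e _ _ (by fun_prop) (by fun_prop),
   e _ _ (by fun_prop) (by fun_prop), e _ _ (by fun_prop) (by fun_prop),
   e _ _ (by fun_prop) (by fun_prop), e _ _ (by fun_prop) (by fun_prop), e2, e2, e3, e3]
  simp only [intervalIntegral.integral_const, Complex.real_smul]
  push_cast
  ring_nf

/-- one-dimensional gluing induction -/
lemma gm_glue1 (P : ℝ → ℝ → Prop)
    (hP : ∀ a b c, a ≤ b → b ≤ c → P a b → P b c → P a c) (δ : ℝ) (hδ : 0 < δ) (a b : ℝ)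
    (hab : δ / 2 ≤ b - a)
    (h : ∀ s t, a ≤ s → t ≤ b → δ / 2 ≤ t - s → t - s ≤ δ → P s t) : P a b := by
  have key : ∀ n : ℕ, ∀ s t, a ≤ s → t ≤ b → δ / 2 ≤ t - s → t - s ≤ 2 ^ n * δ → P s t := by
    intro n
    induction n with
    | zero => intro s t h1 h2 h3 h4; exact h s t h1 h2 h3 (by simpa using h4)
    | succ n ih =>
      intro s t h1 h2 h3 h4
      by_cases hc : t - s ≤ δ
      · exact h s t h1 h2 h3 hc
      · push Not at hc
        rw [pow_succ] at h4
        refine hP s ((s + t) / 2) t (by linarith) (by linarith) (ih _ _ ?_ ?_ ?_ ?_)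
          (ih _ _ ?_ ?_ ?_ ?_) <;> linarith
  obtain ⟨n, hn⟩ := pow_unbounded_of_one_lt ((b - a) / δ) (one_lt_two)
  refine key n a b le_rfl le_rfl hab ?_
  rw [div_lt_iff₀ hδ] at hn
  exact hn.le

lemma gm_glue2 (P : ℝ → ℝ → ℝ → ℝ → Prop)
    (hPx : ∀ a b c y0 y1, a ≤ b → b ≤ c → y0 ≤ y1 → P a b y0 y1 → P b c y0 y1 → P a c y0 y1)
    (hPy : ∀ x0 x1 a b c, a ≤ b → b ≤ c → x0 ≤ x1 → P x0 x1 a b → P x0 x1 b c → P x0 x1 a c)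
    (δ : ℝ) (hδ : 0 < δ) (x0 x1 y0 y1 : ℝ)
    (hx : δ / 2 ≤ x1 - x0) (hy : δ / 2 ≤ y1 - y0)
    (h : ∀ s t u v, x0 ≤ s → t ≤ x1 → δ / 2 ≤ t - s → t - s ≤ δ →
      y0 ≤ u → v ≤ y1 → δ / 2 ≤ v - u → v - u ≤ δ → P s t u v) : P x0 x1 y0 y1 := by
  refine gm_glue1 (fun a b => P a b y0 y1)
    (fun a b c h1 h2 => hPx a b c y0 y1 h1 h2 (by linarith)) δ hδ x0 x1 hx ?_
  intro s t h1 h2 h3 h4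
  refine gm_glue1 (fun a b => P s t a b)
    (fun a b c h1 h2 => hPy s t a b c h1 h2 (by linarith)) δ hδ y0 y1 hy ?_
  intro u v h5 h6 h7 h8
  exact h s t u v h1 h2 h3 h4 h5 h6 h7 h8

/-- Boundary bound. -/
lemma gmA_bound {f : ℝ × ℝ → ℂ} (x0 x1 y0 y1 M δ : ℝ)
    (hx : x0 ≤ x1) (hy : y0 ≤ y1) (hxδ : x1 - x0 ≤ δ) (hyδ : y1 - y0 ≤ δ) (hM : 0 ≤ M)
    (h1 : ∀ x ∈ Icc x0 x1, ‖f (x, y0)‖ ≤ M) (h2 : ∀ x ∈ Icc x0 x1, ‖f (x, y1)‖ ≤ M)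
    (h3 : ∀ y ∈ Icc y0 y1, ‖f (x0, y)‖ ≤ M) (h4 : ∀ y ∈ Icc y0 y1, ‖f (x1, y)‖ ≤ M) :
    ‖gmA f x0 x1 y0 y1‖ ≤ 4 * M * δ := by
  have b : ∀ (g : ℝ → ℂ) (a b : ℝ), a ≤ b → b - a ≤ δ → (∀ x ∈ Icc a b, ‖g x‖ ≤ M) →
      ‖∫ x in a..b, g x‖ ≤ M * δ := by
    intro g a b hab hd h
    have := intervalIntegral.norm_integral_le_of_norm_le_const (a := a) (b := b) (f := g) (C := M)
      (fun x hx => h x (by rw [uIoc_of_le hab] at hx; exact Ioc_subset_Icc_self hx))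
    rw [abs_of_nonneg (by linarith)] at this
    exact this.trans (mul_le_mul_of_nonneg_left hd hM)
  have i1 := b _ x0 x1 hx hxδ h1
  have i2 := b _ x0 x1 hx hxδ h2
  have i3 := b _ y0 y1 hy hyδ h3
  have i4 := b _ y0 y1 hy hyδ h4
  unfold gmA
  refine (norm_sub_le _ _).trans ?_
  refine (add_le_add (norm_add_le _ _) le_rfl).trans ?_
  refine (add_le_add (add_le_add (norm_sub_le _ _) le_rfl) le_rfl).trans ?_
  simp only [norm_mul, Complex.norm_I, one_mul]
  linarith

/-- Bad points: arbitrarily small bad rectangles inside `K` nearby. -/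
def gmT (f : ℝ × ℝ → ℂ) (c : ℝ) (K : Set (ℝ × ℝ)) : Set (ℝ × ℝ) :=
  {w | ∀ r > 0, ∃ s t u v : ℝ, s ≤ t ∧ u ≤ v ∧ Icc s t ×ˢ Icc u v ⊆ Metric.ball w r ∧
    Icc s t ×ˢ Icc u v ⊆ K ∧ c * ((t - s) * (v - u)) < ‖gmA f s t u v‖}

lemma gmT_closed (f : ℝ × ℝ → ℂ) (c : ℝ) (K : Set (ℝ × ℝ)) : IsClosed (gmT f c K) := by
  rw [← isOpen_compl_iff, Metric.isOpen_iff]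
  intro w hw
  simp only [gmT, mem_compl_iff, mem_ofPred_eq, not_forall] at hw
  obtain ⟨r, hr, hw⟩ := hw
  refine ⟨r / 2, by positivity, fun z hz hzT => hw ?_⟩
  obtain ⟨s, t, u, v, h1, h2, h3, h4, h5⟩ := hzT (r / 2) (by positivity)
  refine ⟨s, t, u, v, h1, h2, h3.trans (Metric.ball_subset_ball' ?_), h4, h5⟩
  rw [Metric.mem_ball] at hz
  linarith

lemma gmT_subset (f : ℝ × ℝ → ℂ) (c : ℝ) (K : Set (ℝ × ℝ)) (hK : IsClosed K) :
    gmT f c K ⊆ K := by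
  intro w hw
  rw [← hK.closure_eq, Metric.mem_closure_iff]
  intro r hr
  obtain ⟨s, t, u, v, h1, h2, h3, h4, h5⟩ := hw r hr
  have hm : ((s, u) : ℝ × ℝ) ∈ Icc s t ×ˢ Icc u v := by simp [h1, h2]
  exact ⟨(s, u), h4 hm, by rw [dist_comm]; exact h3 hm⟩

/-- gluing for norm bounds -/
lemma gm_norm_glue {f : ℝ × ℝ → ℂ} (hf : Continuous f) (m : ℝ → ℝ → ℝ → ℝ → ℝ)
    (hmx : ∀ a b c y0 y1, a ≤ b → b ≤ c → y0 ≤ y1 → m a b y0 y1 + m b c y0 y1 ≤ m a c y0 y1)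
    (hmy : ∀ x0 x1 a b c, a ≤ b → b ≤ c → x0 ≤ x1 → m x0 x1 a b + m x0 x1 b c ≤ m x0 x1 a c)
    (δ : ℝ) (hδ : 0 < δ) (x0 x1 y0 y1 : ℝ)
    (hx : δ / 2 ≤ x1 - x0) (hy : δ / 2 ≤ y1 - y0)
    (h : ∀ s t u v, x0 ≤ s → t ≤ x1 → δ / 2 ≤ t - s → t - s ≤ δ →
      y0 ≤ u → v ≤ y1 → δ / 2 ≤ v - u → v - u ≤ δ → ‖gmA f s t u v‖ ≤ m s t u v) :
    ‖gmA f x0 x1 y0 y1‖ ≤ m x0 x1 y0 y1 := by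
  refine gm_glue2 (fun x0 x1 y0 y1 => ‖gmA f x0 x1 y0 y1‖ ≤ m x0 x1 y0 y1) ?_ ?_ δ hδ
    x0 x1 y0 y1 hx hy h
  · intro a b c y0 y1 h1 h2 h3 h4 h5
    rw [gmA_add_x hf a b c]
    exact (norm_add_le _ _).trans ((add_le_add h4 h5).trans (hmx _ _ _ _ _ h1 h2 h3))
  · intro x0 x1 a b c h1 h2 h3 h4 h5
    rw [gmA_add_y hf x0 x1 a b c]
    exact (norm_add_le _ _).trans ((add_le_add h4 h5).trans (hmy _ _ _ _ _ h1 h2 h3))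

lemma gm_off {f : ℝ × ℝ → ℂ} (hf : Continuous f) (c : ℝ) (K : Set (ℝ × ℝ))
    (x0 x1 y0 y1 : ℝ) (hx : x0 ≤ x1) (hy : y0 ≤ y1) (hK : Icc x0 x1 ×ˢ Icc y0 y1 ⊆ K)
    (hT : ∀ w ∈ Icc x0 x1 ×ˢ Icc y0 y1, w ∉ gmT f c K) :
    ‖gmA f x0 x1 y0 y1‖ ≤ c * ((x1 - x0) * (y1 - y0)) := by
  rcases hx.eq_or_lt with rfl | hx'
  · simp [gmA_self_x]
  rcases hy.eq_or_lt with rfl | hy'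
  · simp [gmA_self_y]
  have hT' : ∀ w : (Icc x0 x1 ×ˢ Icc y0 y1 : Set (ℝ × ℝ)), ∃ r > 0, ∀ s t u v : ℝ, s ≤ t → u ≤ v →
      Icc s t ×ˢ Icc u v ⊆ Metric.ball w.1 r → Icc s t ×ˢ Icc u v ⊆ K →
      ‖gmA f s t u v‖ ≤ c * ((t - s) * (v - u)) := by
    intro w
    have := hT w.1 w.2
    simp only [gmT, mem_ofPred_eq, not_forall] at this
    obtain ⟨r, hr, h⟩ := this
    refine ⟨r, hr, fun s t u v h1 h2 h3 h4 => ?_⟩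
    by_contra h5
    exact h ⟨s, t, u, v, h1, h2, h3, h4, not_le.1 h5⟩
  choose r hr hgood using hT'
  have hcomp : IsCompact (Icc x0 x1 ×ˢ Icc y0 y1) := isCompact_Icc.prod isCompact_Icc
  obtain ⟨δ, hδ, hleb⟩ := lebesgue_number_lemma_of_metric hcomp
    (c := fun w => Metric.ball w.1 (r w)) (fun w => Metric.isOpen_ball)
    (fun w hw => mem_iUnion.2 ⟨⟨w, hw⟩, Metric.mem_ball_self (hr _)⟩)
  set d := min (δ / 2) (min (x1 - x0) (y1 - y0)) with hd
  have hd1 : d ≤ δ / 2 := min_le_left _ _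
  have hd2 : d ≤ x1 - x0 := (min_le_right _ _).trans (min_le_left _ _)
  have hd3 : d ≤ y1 - y0 := (min_le_right _ _).trans (min_le_right _ _)
  have hd0 : 0 < d := by
    apply lt_min (by positivity) (lt_min _ _) <;> linarith
  refine gm_norm_glue hf (fun s t u v => c * ((t - s) * (v - u))) ?_ ?_ d hd0 x0 x1 y0 y1
    (by linarith) (by linarith) ?_
  · intros; apply le_of_eq; ring
  · intros; apply le_of_eq; ring
  intro s t u v h1 h2 h3 h4 h5 h6 h7 h8
  have hsu : ((s, u) : ℝ × ℝ) ∈ Icc x0 x1 ×ˢ Icc y0 y1 := by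
    simp only [mem_prod, mem_Icc]; refine ⟨⟨?_, ?_⟩, ?_, ?_⟩ <;> linarith
  obtain ⟨w, hw⟩ := hleb _ hsu
  refine hgood w s t u v (by linarith) (by linarith) ?_ ?_
  · refine Subset.trans ?_ hw
    rintro ⟨p, q⟩ ⟨⟨hp1, hp2⟩, hq1, hq2⟩
    simp only at hp1 hp2 hq1 hq2
    rw [Metric.mem_ball, Prod.dist_eq, max_lt_iff, Real.dist_eq, Real.dist_eq, abs_lt, abs_lt]
    simp only
    refine ⟨⟨?_, ?_⟩, ?_, ?_⟩ <;> linarith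
  · exact Subset.trans (prod_mono (Icc_subset_Icc h1 h2) (Icc_subset_Icc h5 h6)) hK

lemma gm_off' {f : ℝ × ℝ → ℂ} (hf : Continuous f) (c : ℝ) (K : Set (ℝ × ℝ))
    (x0 x1 y0 y1 : ℝ) (hx : x0 ≤ x1) (hy : y0 ≤ y1) (hK : Icc x0 x1 ×ˢ Icc y0 y1 ⊆ K)
    (hT : ∀ w ∈ Ioo x0 x1 ×ˢ Ioo y0 y1, w ∉ gmT f c K) :
    ‖gmA f x0 x1 y0 y1‖ ≤ c * ((x1 - x0) * (y1 - y0)) := by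
  rcases hx.eq_or_lt with rfl | hx'
  · simp [gmA_self_x]
  rcases hy.eq_or_lt with rfl | hy'
  · simp [gmA_self_y]
  have h1 : Tendsto (fun t : ℝ => ‖gmA f (x0 + t) (x1 - t) (y0 + t) (y1 - t)‖) (𝓝[>] 0)
      (𝓝 ‖gmA f x0 x1 y0 y1‖) := by
    have := ((gmA_cont hf x0 x1 y0 y1).norm.tendsto 0).mono_left (nhdsWithin_le_nhds (s := Ioi 0))
    simpa using this
  have h2 : Tendsto (fun t : ℝ => c * ((x1 - t - (x0 + t)) * (y1 - t - (y0 + t)))) (𝓝[>] 0)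
      (𝓝 (c * ((x1 - x0) * (y1 - y0)))) := by
    have : Continuous (fun t : ℝ => c * ((x1 - t - (x0 + t)) * (y1 - t - (y0 + t)))) := by fun_prop
    have := (this.tendsto 0).mono_left (nhdsWithin_le_nhds (s := Ioi 0))
    simpa using this
  refine le_of_tendsto_of_tendsto h1 h2 ?_
  have hpos : 0 < min ((x1 - x0) / 2) ((y1 - y0) / 2) := by
    apply lt_min <;> linarith
  filter_upwards [Ioo_mem_nhdsGT hpos] with t ht
  have ht0 : 0 < t := ht.1
  have ht1 : t < (x1 - x0) / 2 := ht.2.trans_le (min_le_left _ _)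
  have ht2 : t < (y1 - y0) / 2 := ht.2.trans_le (min_le_right _ _)
  refine gm_off hf c K _ _ _ _ (by linarith) (by linarith) ?_ ?_
  · refine Subset.trans (prod_mono (Icc_subset_Icc ?_ ?_) (Icc_subset_Icc ?_ ?_)) hK <;> linarith
  · rintro ⟨p, q⟩ ⟨⟨hp1, hp2⟩, hq1, hq2⟩
    simp only at hp1 hp2 hq1 hq2
    apply hT
    simp only [mem_prod, mem_Ioo]
    refine ⟨⟨?_, ?_⟩, ?_, ?_⟩ <;> linarith

/-- The axis estimate -/
def gmE (f : ℝ × ℝ → ℂ) (D : ℂ) (η δ : ℝ) : Set (ℝ × ℝ) :=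
  {w | ∀ h : ℝ, |h| ≤ δ → ‖f (w.1 + h, w.2) - f w - D * h‖ ≤ η * |h| ∧
    ‖f (w.1, w.2 + h) - f w - D * (Complex.I * h)‖ ≤ η * |h|}

lemma gmE_closed {f : ℝ × ℝ → ℂ} (hf : Continuous f) (D : ℂ) (η δ : ℝ) :
    IsClosed (gmE f D η δ) := by
  simp only [gmE, ofPred_forall]
  refine isClosed_iInter fun h => isClosed_iInter fun _ => ?_
  exact (isClosed_le (by fun_prop) (by fun_prop)).and (isClosed_le (by fun_prop) (by fun_prop))

/-- Estimate on the bounding box whose sides touch `E`. -/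
lemma gm_box {f : ℝ × ℝ → ℂ} (hf : Continuous f) (D : ℂ) (η δ : ℝ) (hη : 0 ≤ η) (hδ : 0 ≤ δ)
    (a b c d xb xt yl yr : ℝ) (hab : a ≤ b) (hcd : c ≤ d) (hab' : b - a ≤ δ) (hcd' : d - c ≤ δ)
    (hxb : xb ∈ Icc a b) (hxt : xt ∈ Icc a b) (hyl : yl ∈ Icc c d) (hyr : yr ∈ Icc c d)
    (hb : (xb, c) ∈ gmE f D η δ) (ht : (xt, d) ∈ gmE f D η δ)
    (hl : (a, yl) ∈ gmE f D η δ) (hr : (b, yr) ∈ gmE f D η δ) :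
    ‖gmA f a b c d‖ ≤ 20 * η * δ ^ 2 := by
  set g : ℝ × ℝ → ℂ := fun p => f p - D * ((p.1 : ℂ) + Complex.I * p.2) with hg
  have hor : ∀ x x' y : ℝ, (x, y) ∈ gmE f D η δ → x ∈ Icc a b → x' ∈ Icc a b →
      ‖g (x', y) - g (x, y)‖ ≤ η * δ := by
    intro x x' y h hx hx'
    have habs : |x' - x| ≤ δ := by
      rw [abs_le]; constructor <;> linarith [hx.1, hx.2, hx'.1, hx'.2]
    have := (h (x' - x) habs).1
    simp only [add_sub_cancel] at this
    refine le_trans (le_of_eq ?_) (this.trans (mul_le_mul_of_nonneg_left habs hη))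
    congr 1; simp only [hg]; push_cast; ring
  have ver : ∀ x y y' : ℝ, (x, y) ∈ gmE f D η δ → y ∈ Icc c d → y' ∈ Icc c d →
      ‖g (x, y') - g (x, y)‖ ≤ η * δ := by
    intro x y y' h hx hx'
    have habs : |y' - y| ≤ δ := by
      rw [abs_le]; constructor <;> linarith [hx.1, hx.2, hx'.1, hx'.2]
    have := (h (y' - y) habs).2
    simp only [add_sub_cancel] at this
    refine le_trans (le_of_eq ?_) (this.trans (mul_le_mul_of_nonneg_left habs hη))
    congr 1; simp only [hg]; push_cast; ring
  have ha' : a ∈ Icc a b := ⟨le_rfl, hab⟩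
  have hb' : b ∈ Icc a b := ⟨hab, le_rfl⟩
  have hc' : c ∈ Icc c d := ⟨le_rfl, hcd⟩
  have hd' : d ∈ Icc c d := ⟨hcd, le_rfl⟩
  have tri : ∀ u v w : ℂ, ‖u - w‖ ≤ ‖u - v‖ + ‖v - w‖ := norm_sub_le_norm_sub_add_norm_sub
  have hm : 0 ≤ η * δ := mul_nonneg hη hδ
  -- everything is close to `g (a, c)`
  have kb : ∀ x ∈ Icc a b, ‖g (x, c) - g (a, c)‖ ≤ 2 * (η * δ) := by
    intro x hx
    have h1 := hor xb x c hb hxb hx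
    have h2 := hor xb a c hb hxb ha'
    rw [norm_sub_rev] at h2
    linarith [tri (g (x, c)) (g (xb, c)) (g (a, c))]
  have kl : ∀ y ∈ Icc c d, ‖g (a, y) - g (a, c)‖ ≤ 2 * (η * δ) := by
    intro y hy
    have h1 := ver a yl y hl hyl hy
    have h2 := ver a yl c hl hyl hc'
    rw [norm_sub_rev] at h2
    linarith [tri (g (a, y)) (g (a, yl)) (g (a, c))]
  have kr : ∀ y ∈ Icc c d, ‖g (b, y) - g (a, c)‖ ≤ 5 * (η * δ) := by
    intro y hy
    have h1 := ver b yr y hr hyr hy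
    have h2 := ver b yr c hr hyr hc'
    rw [norm_sub_rev] at h2
    linarith [tri (g (b, y)) (g (b, yr)) (g (b, c)), tri (g (b, y)) (g (b, c)) (g (a, c)),
      kb b hb']
  have kt : ∀ x ∈ Icc a b, ‖g (x, d) - g (a, c)‖ ≤ 5 * (η * δ) := by
    intro x hx
    have h1 := hor xt x d ht hxt hx
    have h2 := hor xt a d ht hxt ha'
    rw [norm_sub_rev] at h2
    linarith [tri (g (x, d)) (g (xt, d)) (g (a, d)), tri (g (x, d)) (g (a, d)) (g (a, c)),
      kl d hd']
  rw [← gmA_linear hf a b c d D (g (a, c))]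
  have := gmA_bound (f := fun p => g p - g (a, c)) a b c d (5 * (η * δ)) δ hab hcd hab' hcd'
    (by positivity) (fun x hx => (kb x hx).trans (by linarith)) kt
    (fun x hx => (kl x hx).trans (by linarith)) kr
  refine this.trans (le_of_eq (by ring))

lemma gm_cell {f : ℝ × ℝ → ℂ} (hf : Continuous f) (c : ℝ) (K : Set (ℝ × ℝ))
    (D : ℂ) (η δ : ℝ) (hη : 0 ≤ η) (hδ : 0 ≤ δ)
    (x0 x1 y0 y1 : ℝ) (hx : x0 ≤ x1) (hy : y0 ≤ y1) (hK : Icc x0 x1 ×ˢ Icc y0 y1 ⊆ K)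
    (hx' : x1 - x0 ≤ δ) (hy' : y1 - y0 ≤ δ)
    (hne : (gmT f c K ∩ Icc x0 x1 ×ˢ Icc y0 y1).Nonempty)
    (hE : gmT f c K ∩ Icc x0 x1 ×ˢ Icc y0 y1 ⊆ gmE f D η δ) :
    ∃ a b p q : ℝ, a ≤ b ∧ p ≤ q ∧ gmT f c K ∩ Icc x0 x1 ×ˢ Icc y0 y1 ⊆ Icc a b ×ˢ Icc p q ∧
      ‖gmA f x0 x1 y0 y1‖ ≤ 20 * η * δ ^ 2 + c * ((x1 - x0) * (y1 - y0) - (b - a) * (q - p)) := by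
  set S := gmT f c K ∩ Icc x0 x1 ×ˢ Icc y0 y1 with hS
  have hScomp : IsCompact S :=
    (isCompact_Icc.prod isCompact_Icc).inter_left (gmT_closed f c K)
  obtain ⟨wl, hwl, hl⟩ := hScomp.exists_isMinOn hne continuous_fst.continuousOn
  obtain ⟨wr, hwr, hr⟩ := hScomp.exists_isMaxOn hne continuous_fst.continuousOn
  obtain ⟨wb, hwb, hb⟩ := hScomp.exists_isMinOn hne continuous_snd.continuousOn
  obtain ⟨wt, hwt, ht⟩ := hScomp.exists_isMaxOn hne continuous_snd.continuousOn
  have hl' : ∀ w ∈ S, wl.1 ≤ w.1 := fun w hw => hl hw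
  have hr' : ∀ w ∈ S, w.1 ≤ wr.1 := fun w hw => hr hw
  have hb' : ∀ w ∈ S, wb.2 ≤ w.2 := fun w hw => hb hw
  have ht' : ∀ w ∈ S, w.2 ≤ wt.2 := fun w hw => ht hw
  have hab := hl' _ hwr
  have hpq := hb' _ hwt
  have i1 : x0 ≤ wl.1 := hwl.2.1.1
  have i2 : wr.1 ≤ x1 := hwr.2.1.2
  have i3 : y0 ≤ wb.2 := hwb.2.2.1
  have i4 : wt.2 ≤ y1 := hwt.2.2.2
  refine ⟨wl.1, wr.1, wb.2, wt.2, hab, hpq, fun w hw =>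
    ⟨⟨hl' w hw, hr' w hw⟩, hb' w hw, ht' w hw⟩, ?_⟩
  have hbox := gm_box hf D η δ hη hδ wl.1 wr.1 wb.2 wt.2 wb.1 wt.1 wl.2 wr.2 hab hpq
    (by linarith) (by linarith) ⟨hl' _ hwb, hr' _ hwb⟩ ⟨hl' _ hwt, hr' _ hwt⟩
    ⟨hb' _ hwl, ht' _ hwl⟩ ⟨hb' _ hwr, ht' _ hwr⟩ (hE hwb) (hE hwt) (hE hwl) (hE hwr)
  have off : ∀ s t u v : ℝ, x0 ≤ s → s ≤ t → t ≤ x1 → y0 ≤ u → u ≤ v → v ≤ y1 →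
      (t ≤ wl.1 ∨ wr.1 ≤ s ∨ v ≤ wb.2 ∨ wt.2 ≤ u) →
      ‖gmA f s t u v‖ ≤ c * ((t - s) * (v - u)) := by
    intro s t u v h1 h2 h3 h4 h5 h6 h7
    refine gm_off' hf c K s t u v h2 h5
      (Subset.trans (prod_mono (Icc_subset_Icc h1 h3) (Icc_subset_Icc h4 h6)) hK) ?_
    rintro w ⟨⟨k1, k2⟩, k3, k4⟩ hwT
    have hwS : w ∈ S := ⟨hwT, ⟨by linarith, by linarith⟩, by linarith, by linarith⟩
    rcases h7 with h7 | h7 | h7 | h7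
    · linarith [hl' w hwS]
    · linarith [hr' w hwS]
    · linarith [hb' w hwS]
    · linarith [ht' w hwS]
  have o1 := off x0 wl.1 y0 y1 le_rfl i1 (by linarith) le_rfl hy le_rfl (Or.inl le_rfl)
  have o2 := off wr.1 x1 y0 y1 (by linarith) i2 le_rfl le_rfl hy le_rfl (Or.inr (Or.inl le_rfl))
  have o3 := off wl.1 wr.1 y0 wb.2 i1 hab i2 le_rfl i3 (by linarith)
    (Or.inr (Or.inr (Or.inl le_rfl)))
  have o4 := off wl.1 wr.1 wt.2 y1 i1 hab i2 (by linarith) i4 le_rfl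
    (Or.inr (Or.inr (Or.inr le_rfl)))
  rw [gmA_add_x hf x0 wl.1 x1, gmA_add_x hf wl.1 wr.1 x1, gmA_add_y hf wl.1 wr.1 y0 wb.2 y1,
    gmA_add_y hf wl.1 wr.1 wb.2 wt.2 y1]
  have n1 := norm_add_le (gmA f x0 wl.1 y0 y1) (gmA f wl.1 wr.1 y0 wb.2 +
    (gmA f wl.1 wr.1 wb.2 wt.2 + gmA f wl.1 wr.1 wt.2 y1) + gmA f wr.1 x1 y0 y1)
  have n2 := norm_add_le (gmA f wl.1 wr.1 y0 wb.2 +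
    (gmA f wl.1 wr.1 wb.2 wt.2 + gmA f wl.1 wr.1 wt.2 y1)) (gmA f wr.1 x1 y0 y1)
  have n3 := norm_add_le (gmA f wl.1 wr.1 y0 wb.2)
    (gmA f wl.1 wr.1 wb.2 wt.2 + gmA f wl.1 wr.1 wt.2 y1)
  have n4 := norm_add_le (gmA f wl.1 wr.1 wb.2 wt.2) (gmA f wl.1 wr.1 wt.2 y1)
  have : c * ((x1 - x0) * (y1 - y0) - (wr.1 - wl.1) * (wt.2 - wb.2)) =
    c * ((wl.1 - x0) * (y1 - y0)) + c * ((x1 - wr.1) * (y1 - y0)) +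
    c * ((wr.1 - wl.1) * (wb.2 - y0)) + c * ((wr.1 - wl.1) * (y1 - wt.2)) := by ring
  linarith

/-- Area of the part of a half-open rectangle in `S`. -/
def gmM (S : Set (ℝ × ℝ)) (s t u v : ℝ) : ℝ :=
  MeasureTheory.volume.real ((Ioc s t ×ˢ Ioc u v) ∩ S)

lemma gm_fin (S : Set (ℝ × ℝ)) (s t u v : ℝ) :
    MeasureTheory.volume ((Ioc s t ×ˢ Ioc u v) ∩ S) ≠ ⊤ := by
  refine ((MeasureTheory.measure_mono inter_subset_left).trans_lt ?_).ne
  rw [MeasureTheory.Measure.volume_eq_prod, MeasureTheory.Measure.prod_prod]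
  simp [ENNReal.mul_lt_top]

lemma gmM_mono {S S' : Set (ℝ × ℝ)} (s t u v : ℝ)
    (h : (Ioc s t ×ˢ Ioc u v) ∩ S ⊆ S') : gmM S s t u v ≤ gmM S' s t u v :=
  MeasureTheory.measureReal_mono (subset_inter inter_subset_left h) (gm_fin _ _ _ _ _)

lemma gmM_univ (s t u v : ℝ) (h : s ≤ t) (h' : u ≤ v) : gmM univ s t u v = (t - s) * (v - u) := by
  rw [gmM, inter_univ, MeasureTheory.Measure.volume_eq_prod, MeasureTheory.measureReal_prod_prod,
    Real.volume_real_Ioc_of_le h, Real.volume_real_Ioc_of_le h']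

lemma gmM_x (S : Set (ℝ × ℝ)) (hS : MeasurableSet S) (a b c y0 y1 : ℝ) (h1 : a ≤ b) (h2 : b ≤ c) :
    gmM S a b y0 y1 + gmM S b c y0 y1 = gmM S a c y0 y1 := by
  unfold gmM
  rw [← MeasureTheory.measureReal_union ?_ ?_ (gm_fin _ _ _ _ _) (gm_fin _ _ _ _ _)]
  · rw [← union_inter_distrib_right, ← union_prod, Ioc_union_Ioc_eq_Ioc h1 h2]
  · rw [Set.disjoint_left]
    rintro ⟨x, y⟩ ⟨⟨⟨h3, h4⟩, h5⟩, h6⟩ ⟨⟨⟨h7, h8⟩, h9⟩, h10⟩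
    simp only at h3 h4 h7 h8
    linarith
  · exact (measurableSet_Ioc.prod measurableSet_Ioc).inter hS

lemma gmM_y (S : Set (ℝ × ℝ)) (hS : MeasurableSet S) (x0 x1 a b c : ℝ) (h1 : a ≤ b) (h2 : b ≤ c) :
    gmM S x0 x1 a b + gmM S x0 x1 b c = gmM S x0 x1 a c := by
  unfold gmM
  rw [← MeasureTheory.measureReal_union ?_ ?_ (gm_fin _ _ _ _ _) (gm_fin _ _ _ _ _)]
  · rw [← union_inter_distrib_right, ← prod_union, Ioc_union_Ioc_eq_Ioc h1 h2]
  · rw [Set.disjoint_left]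
    rintro ⟨x, y⟩ ⟨⟨h5, h3, h4⟩, h6⟩ ⟨⟨h9, h7, h8⟩, h10⟩
    simp only at h3 h4 h7 h8
    linarith
  · exact (measurableSet_Ioc.prod measurableSet_Ioc).inter hS

lemma gmM_compl (S : Set (ℝ × ℝ)) (hS : MeasurableSet S) (s t u v : ℝ) :
    gmM S s t u v + gmM Sᶜ s t u v = gmM univ s t u v := by
  unfold gmM
  rw [← MeasureTheory.measureReal_union ?_ ?_ (gm_fin _ _ _ _ _) (gm_fin _ _ _ _ _),
    ← inter_union_distrib_left, union_compl_self]
  · rw [Set.disjoint_left]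
    rintro w ⟨_, h⟩ ⟨_, h'⟩
    exact h' h
  · exact (measurableSet_Ioc.prod measurableSet_Ioc).inter hS.compl

lemma gmM_Icc (a b p q s t u v : ℝ) (h : a ≤ b) (h' : p ≤ q) :
    gmM (Icc a b ×ˢ Icc p q) s t u v ≤ (b - a) * (q - p) := by
  have : MeasureTheory.volume.real (Icc a b ×ˢ Icc p q) = (b - a) * (q - p) := by
    rw [MeasureTheory.Measure.volume_eq_prod, MeasureTheory.measureReal_prod_prod,
      Real.volume_real_Icc_of_le h, Real.volume_real_Icc_of_le h']
  rw [← this]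
  refine MeasureTheory.measureReal_mono inter_subset_right ?_
  exact (isCompact_Icc.prod isCompact_Icc).measure_lt_top.ne

lemma gm_main {f : ℝ × ℝ → ℂ} (hf : Continuous f) (c : ℝ) (hc : 0 < c) (K : Set (ℝ × ℝ))
    (D : ℂ) (η δ0 : ℝ) (hη : 0 ≤ η) (hηc : 80 * η ≤ c) (hδ0 : 0 < δ0)
    (x0 x1 y0 y1 : ℝ) (hx : x0 ≤ x1) (hy : y0 ≤ y1) (hK : Icc x0 x1 ×ˢ Icc y0 y1 ⊆ K)
    (hE : gmT f c K ∩ Icc x0 x1 ×ˢ Icc y0 y1 ⊆ gmE f D η δ0) :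
    ‖gmA f x0 x1 y0 y1‖ ≤ c * ((x1 - x0) * (y1 - y0)) := by
  rcases hx.eq_or_lt with rfl | hx'
  · simp [gmA_self_x]
  rcases hy.eq_or_lt with rfl | hy'
  · simp [gmA_self_y]
  set T := gmT f c K with hTdef
  have hTm : MeasurableSet T := (gmT_closed f c K).measurableSet
  have step : ∀ᶠ δ in 𝓝[>] (0:ℝ), ‖gmA f x0 x1 y0 y1‖ ≤
      c * gmM Tᶜ x0 x1 y0 y1 + 80 * η * gmM (Metric.cthickening δ T) x0 x1 y0 y1 := by
    have hpos : 0 < min δ0 (min (x1 - x0) (y1 - y0)) := by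
      apply lt_min hδ0 (lt_min _ _) <;> linarith
    filter_upwards [Ioo_mem_nhdsGT hpos] with δ hδ
    have hδp : 0 < δ := hδ.1
    have hd1 : δ ≤ δ0 := hδ.2.le.trans (min_le_left _ _)
    have hd2 : δ ≤ x1 - x0 := hδ.2.le.trans ((min_le_right _ _).trans (min_le_left _ _))
    have hd3 : δ ≤ y1 - y0 := hδ.2.le.trans ((min_le_right _ _).trans (min_le_right _ _))
    have hCm : MeasurableSet (Metric.cthickening δ T) := Metric.isClosed_cthickening.measurableSet
    refine gm_norm_glue hf (fun s t u v => c * gmM Tᶜ s t u v +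
      80 * η * gmM (Metric.cthickening δ T) s t u v) ?_ ?_ δ hδp x0 x1 y0 y1
      (by linarith) (by linarith) ?_
    · intro a b d y0 y1 h1 h2 _
      rw [← gmM_x Tᶜ hTm.compl a b d y0 y1 h1 h2, ← gmM_x _ hCm a b d y0 y1 h1 h2]
      apply le_of_eq; ring
    · intro x0 x1 a b d h1 h2 _
      rw [← gmM_y Tᶜ hTm.compl x0 x1 a b d h1 h2, ← gmM_y _ hCm x0 x1 a b d h1 h2]
      apply le_of_eq; ring
    intro s t u v h1 h2 h3 h4 h5 h6 h7 h8
    have hst : s ≤ t := by linarith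
    have huv : u ≤ v := by linarith
    have hsub : Icc s t ×ˢ Icc u v ⊆ Icc x0 x1 ×ˢ Icc y0 y1 :=
      prod_mono (Icc_subset_Icc h1 h2) (Icc_subset_Icc h5 h6)
    have hsub' : Ioc s t ×ˢ Ioc u v ⊆ Icc s t ×ˢ Icc u v :=
      prod_mono Ioc_subset_Icc_self Ioc_subset_Icc_self
    have hnn : 0 ≤ gmM (Metric.cthickening δ T) s t u v := MeasureTheory.measureReal_nonneg
    rcases (T ∩ Icc s t ×ˢ Icc u v).eq_empty_or_nonempty with hemp | hne
    · have hoff := gm_off hf c K s t u v hst huv (hsub.trans hK) (by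
        intro w hw hwT
        have : w ∈ T ∩ Icc s t ×ˢ Icc u v := ⟨hwT, hw⟩
        rw [hemp] at this; exact this)
      have h9 : gmM univ s t u v ≤ gmM Tᶜ s t u v := by
        apply gmM_mono
        rintro w ⟨hw, _⟩ hwT
        have : w ∈ T ∩ Icc s t ×ˢ Icc u v := ⟨hwT, hsub' hw⟩
        rw [hemp] at this; exact this
      rw [gmM_univ s t u v hst huv] at h9
      have := mul_le_mul_of_nonneg_left h9 hc.le
      have : 0 ≤ 80 * η * gmM (Metric.cthickening δ T) s t u v := by positivity
      linarith
    · obtain ⟨a, b, p, q, hab, hpq, hbox, hbd⟩ := gm_cell hf c K D η δ hη hδp.le s t u v hst huv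
        (hsub.trans hK) h4 h8 hne (by
          rintro w ⟨hw1, hw2⟩ h hh
          exact hE ⟨hw1, hsub hw2⟩ h (hh.trans hd1))
      have k1 : gmM univ s t u v ≤ gmM (Metric.cthickening δ T) s t u v := by
        apply gmM_mono
        rintro w ⟨hw, _⟩
        have hw := hsub' hw
        obtain ⟨w', hw', hw''⟩ := hne
        refine Metric.mem_cthickening_of_dist_le w w' δ T hw' ?_
        rw [Prod.dist_eq, max_le_iff, Real.dist_eq, Real.dist_eq, abs_le, abs_le]
        obtain ⟨⟨l1, l2⟩, l3, l4⟩ := hw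
        obtain ⟨⟨m1, m2⟩, m3, m4⟩ := hw''
        refine ⟨⟨?_, ?_⟩, ?_, ?_⟩ <;> linarith
      have k2 : gmM T s t u v ≤ (b - a) * (q - p) := by
        refine (gmM_mono s t u v ?_).trans (gmM_Icc a b p q s t u v hab hpq)
        rintro w ⟨hw, hwT⟩
        exact hbox ⟨hwT, hsub' hw⟩
      have k3 := gmM_compl T hTm s t u v
      rw [gmM_univ s t u v hst huv] at k1 k3
      have k4 : δ ^ 2 ≤ 4 * ((t - s) * (v - u)) := by nlinarith
      have k5 : 20 * η * δ ^ 2 ≤ 80 * η * gmM (Metric.cthickening δ T) s t u v := by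
        have : 20 * η * δ ^ 2 ≤ 20 * η * (4 * gmM (Metric.cthickening δ T) s t u v) :=
          mul_le_mul_of_nonneg_left (by linarith) (by positivity)
        linarith
      have k6 : c * ((t - s) * (v - u) - (b - a) * (q - p)) ≤ c * gmM Tᶜ s t u v :=
        mul_le_mul_of_nonneg_left (by linarith) hc.le
      linarith
  have hlim : Tendsto (fun δ => gmM (Metric.cthickening δ T) x0 x1 y0 y1) (𝓝[>] (0:ℝ))
      (𝓝 (gmM T x0 x1 y0 y1)) := by
    set μ := (MeasureTheory.volume : MeasureTheory.Measure (ℝ × ℝ)).restrict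
      (Ioc x0 x1 ×ˢ Ioc y0 y1) with hμ
    have hap : ∀ S : Set (ℝ × ℝ), MeasurableSet S → gmM S x0 x1 y0 y1 = (μ S).toReal := by
      intro S hS
      rw [hμ, MeasureTheory.Measure.restrict_apply hS, inter_comm]; rfl
    have hfin : ∀ S : Set (ℝ × ℝ), MeasurableSet S → μ S ≠ ⊤ := by
      intro S hS
      rw [hμ, MeasureTheory.Measure.restrict_apply hS, inter_comm]
      exact gm_fin _ _ _ _ _
    have := tendsto_measure_cthickening_of_isClosed (μ := μ) (s := T)
      ⟨1, one_pos, hfin _ Metric.isClosed_cthickening.measurableSet⟩ (gmT_closed f c K)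
    have := (ENNReal.tendsto_toReal (hfin T hTm)).comp this
    rw [hap T hTm]
    refine (this.mono_left (nhdsWithin_le_nhds (s := Ioi 0))).congr ?_
    intro δ
    rw [hap _ Metric.isClosed_cthickening.measurableSet]; rfl
  have hfinal := ge_of_tendsto ((hlim.const_mul (80 * η)).const_add (c * gmM Tᶜ x0 x1 y0 y1)) step
  have k3 := gmM_compl T hTm x0 x1 y0 y1
  rw [gmM_univ x0 x1 y0 y1 hx hy] at k3
  have : 80 * η * gmM T x0 x1 y0 y1 ≤ c * gmM T x0 x1 y0 y1 :=
    mul_le_mul_of_nonneg_right hηc MeasureTheory.measureReal_nonneg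
  rw [← k3]
  linarith

/-- Looman--Menchoff type theorem: vanishing of the boundary integral. -/
lemma gm_zero {f : ℝ × ℝ → ℂ} (hf : Continuous f) (x0 x1 y0 y1 : ℝ) (hx : x0 ≤ x1) (hy : y0 ≤ y1)
    (hd : ∀ w ∈ Icc x0 x1 ×ˢ Icc y0 y1, ∃ D : ℂ,
      HasDerivAt (fun h : ℝ => f (w.1 + h, w.2)) D 0 ∧
      HasDerivAt (fun h : ℝ => f (w.1, w.2 + h)) (D * Complex.I) 0) :
    gmA f x0 x1 y0 y1 = 0 := by
  set K := Icc x0 x1 ×ˢ Icc y0 y1 with hKdef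
  have hKc : IsClosed K := isClosed_Icc.prod isClosed_Icc
  have main : ∀ c : ℝ, 0 < c → ‖gmA f x0 x1 y0 y1‖ ≤ c * ((x1 - x0) * (y1 - y0)) := by
    intro c hc
    refine gm_off hf c K x0 x1 y0 y1 hx hy le_rfl ?_
    intro w hw hwT
    set T := gmT f c K with hT
    have hTc : IsClosed T := gmT_closed f c K
    have : CompleteSpace T := hTc.completeSpace_coe
    have : Nonempty T := ⟨⟨w, hwT⟩⟩
    set η := c / 80 with hη
    have hηp : 0 < η := by positivity
    obtain ⟨⟨n, q⟩, hinter⟩ := nonempty_interior_of_iUnion_of_closed (X := T)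
      (f := fun i : ℕ × ℕ => (Subtype.val ⁻¹' gmE f (TopologicalSpace.denseSeq ℂ i.2) η
        (1 / ((i.1 : ℝ) + 1)) : Set T))
      (fun i => (gmE_closed hf _ _ _).preimage continuous_subtype_val) (by
        rw [eq_univ_iff_forall]
        intro z
        obtain ⟨D, hD1, hD2⟩ := hd z.1 (gmT_subset f c K hKc z.2)
        obtain ⟨_, hq, ⟨q, rfl⟩⟩ := Metric.dense_iff.1 (TopologicalSpace.denseRange_denseSeq ℂ) D
          (η / 2) (by positivity)
        rw [Metric.mem_ball, dist_eq_norm] at hq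
        have b1 := (hasDerivAt_iff_isLittleO.1 hD1).def (c := η / 2) (by positivity)
        have b2 := (hasDerivAt_iff_isLittleO.1 hD2).def (c := η / 2) (by positivity)
        obtain ⟨r, hr, hb⟩ := Metric.eventually_nhds_iff.1 (b1.and b2)
        obtain ⟨n, hn⟩ := exists_nat_one_div_lt hr
        refine mem_iUnion.2 ⟨(n, q), ?_⟩
        intro h hh
        have hb' := @hb h (by rw [Real.dist_eq, sub_zero]; exact hh.trans_lt hn)
        set d := TopologicalSpace.denseSeq ℂ q
        simp only [add_zero, sub_zero, Complex.real_smul, Real.norm_eq_abs] at hb'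
        have e0 : ‖(D - d) * (h : ℂ)‖ ≤ η / 2 * |h| := by
          rw [norm_mul, norm_sub_rev, Complex.norm_real, Real.norm_eq_abs]
          exact mul_le_mul_of_nonneg_right hq.le (abs_nonneg _)
        constructor
        · have : f (z.1.1 + h, z.1.2) - f z.1 - d * h =
            (f (z.1.1 + h, z.1.2) - f (z.1.1, z.1.2) - h * D) + (D - d) * h := by ring
          rw [this]
          exact (norm_add_le _ _).trans (by linarith [hb'.1])
        · have : f (z.1.1, z.1.2 + h) - f z.1 - d * (Complex.I * h) =
            (f (z.1.1, z.1.2 + h) - f (z.1.1, z.1.2) - h * (D * Complex.I)) +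
              (D - d) * h * Complex.I := by ring
          rw [this]
          refine (norm_add_le _ _).trans ?_
          rw [norm_mul _ Complex.I, Complex.norm_I, mul_one]
          linarith [hb'.2])
    obtain ⟨z, hz⟩ := hinter
    rw [mem_interior_iff_mem_nhds, Metric.mem_nhds_iff] at hz
    obtain ⟨r, hr, hball⟩ := hz
    obtain ⟨s, t, u, v, h1, h2, h3, h4, h5⟩ := z.2 r hr
    refine absurd (gm_main hf c hc K (TopologicalSpace.denseSeq ℂ q) η (1 / ((n : ℝ) + 1)) hηp.le
      (by rw [hη]; linarith) (by positivity) s t u v h1 h2 h4 ?_) (not_le.2 h5)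
    rintro p ⟨hp, hp'⟩
    exact @hball ⟨p, hp⟩ (h3 hp')
  have hlim : Tendsto (fun c : ℝ => c * ((x1 - x0) * (y1 - y0))) (𝓝[>] 0) (𝓝 0) := by
    have : Continuous (fun c : ℝ => c * ((x1 - x0) * (y1 - y0))) := by fun_prop
    have := (this.tendsto 0).mono_left (nhdsWithin_le_nhds (s := Ioi 0))
    simpa using this
  have := ge_of_tendsto hlim (eventually_mem_nhdsWithin.mono fun c hc => main c hc)
  exact norm_le_zero_iff.1 this

theorem gm_deriv {G : ℂ → ℂ} {w D : ℂ}
    (h : ∀ h : ℂ, Tendsto (fun ε : ℝ => (ε : ℂ)⁻¹ * (G (w + ε * h) - G w)) (𝓝[>] 0) (𝓝 (D * h)))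
    (e : ℂ) : HasDerivAt (fun t : ℝ => G (w + t * e)) (D * e) 0 := by
  rw [hasDerivAt_iff_tendsto_slope_zero, ← nhdsLT_sup_nhdsGT, tendsto_sup]
  constructor
  · have h1 := h (-e)
    have h2 : Tendsto (fun x : ℝ => -x) (𝓝[<] 0) (𝓝[>] 0) := by
      simpa using (tendsto_neg_nhdsLT (a := (0 : ℝ)))
    have h3 := (h1.comp h2).neg
    refine (h3.congr ?_).trans (by simp)
    intro x
    simp [inv_neg]
  · refine (h e).congr ?_
    intro x
    simp

theorem gmA_swapx (f : ℝ × ℝ → ℂ) (x0 x1 y0 y1 : ℝ) :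
    gmA f x1 x0 y0 y1 = - gmA f x0 x1 y0 y1 := by
  unfold gmA
  rw [intervalIntegral.integral_symm x0 x1, intervalIntegral.integral_symm x0 x1]
  ring

theorem gmA_swapy (f : ℝ × ℝ → ℂ) (x0 x1 y0 y1 : ℝ) :
    gmA f x0 x1 y1 y0 = - gmA f x0 x1 y0 y1 := by
  unfold gmA
  rw [intervalIntegral.integral_symm y0 y1, intervalIntegral.integral_symm y0 y1]
  ring

/-- Clamp a real number to `[c - r, c + r]`. -/
def gmcl (c r t : ℝ) : ℝ := max (c - r) (min t (c + r))

theorem gmcl_cont (c r : ℝ) : Continuous (gmcl c r) := by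
  unfold gmcl; fun_prop

theorem gmcl_mem (c r t : ℝ) (hr : 0 ≤ r) : |gmcl c r t - c| ≤ r := by
  unfold gmcl
  rw [abs_le]
  constructor
  · have := le_max_left (c - r) (min t (c + r)); linarith
  · have : max (c - r) (min t (c + r)) ≤ c + r := max_le (by linarith) (min_le_right _ _)
    linarith

theorem gmcl_eq {c r t : ℝ} (h : |t - c| < r) : gmcl c r t = t := by
  unfold gmcl
  rw [abs_lt] at h
  rw [min_eq_left (by linarith), max_eq_right (by linarith)]

theorem gm_holo {G : ℂ → ℂ} {V : Set ℂ} (hV : IsOpen V) (hG : ContinuousOn G V)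
    (hd : ∀ w ∈ V, ∃ D : ℂ, ∀ h : ℂ,
      Tendsto (fun ε : ℝ => (ε : ℂ)⁻¹ * (G (w + ε * h) - G w)) (𝓝[>] 0) (𝓝 (D * h))) :
    DifferentiableOn ℂ G V := by
  intro c hc
  obtain ⟨R, hR, hRV⟩ := Metric.isOpen_iff.mp hV c hc
  set r : ℝ := R / 3 with hr
  have hr0 : 0 < r := by positivity
  have hsq : ∀ w : ℂ, |w.re - c.re| ≤ r → |w.im - c.im| ≤ r → w ∈ V := by
    intro w h1 h2
    apply hRV
    rw [Metric.mem_ball, dist_eq_norm]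
    have := Complex.norm_le_abs_re_add_abs_im (w - c)
    simp only [Complex.sub_re, Complex.sub_im] at this
    linarith
  set f : ℝ × ℝ → ℂ := fun p => G (⟨gmcl c.re r p.1, gmcl c.im r p.2⟩ : ℂ) with hf
  have hfc : Continuous f := by
    refine hG.comp_continuous (f := fun p : ℝ × ℝ => (⟨gmcl c.re r p.1, gmcl c.im r p.2⟩ : ℂ)) ?_ ?_
    · have h1 : Continuous fun p : ℝ × ℝ => gmcl c.re r p.1 := (gmcl_cont _ _).comp continuous_fst
      have h2 : Continuous fun p : ℝ × ℝ => gmcl c.im r p.2 := (gmcl_cont _ _).comp continuous_snd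
      have h3 : Continuous fun p : ℝ × ℝ =>
          ((gmcl c.re r p.1 : ℂ) + (gmcl c.im r p.2 : ℂ) * Complex.I) := by fun_prop
      refine h3.congr ?_
      intro p
      apply Complex.ext <;> simp
    · intro p
      exact hsq _ (gmcl_mem _ _ _ hr0.le) (gmcl_mem _ _ _ hr0.le)
  have hfe : ∀ x y : ℝ, |x - c.re| < r → |y - c.im| < r → f (x, y) = G (x + y * Complex.I) := by
    intro x y h1 h2
    simp only [hf]
    rw [gmcl_eq h1, gmcl_eq h2, Complex.mk_eq_add_mul_I]
  have hder : ∀ x y : ℝ, |x - c.re| < r → |y - c.im| < r → ∃ D : ℂ,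
      HasDerivAt (fun h : ℝ => f (x + h, y)) D 0 ∧
      HasDerivAt (fun h : ℝ => f (x, y + h)) (D * Complex.I) 0 := by
    intro x y h1 h2
    obtain ⟨D, hD⟩ := hd (x + y * Complex.I) (hsq _ (by simpa using h1.le) (by simpa using h2.le))
    refine ⟨D, ?_, ?_⟩
    · have h3 := gm_deriv hD 1
      rw [mul_one] at h3
      refine h3.congr_of_eventuallyEq ?_
      have : ∀ᶠ h : ℝ in 𝓝 0, |x + h - c.re| < r := by
        apply (by fun_prop : Continuous fun h : ℝ => |x + h - c.re|).continuousAt.eventually_lt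
          continuousAt_const
        simpa using h1
      filter_upwards [this] with h hh
      rw [hfe _ _ hh h2]
      congr 1
      push_cast
      ring
    · have h3 := gm_deriv hD Complex.I
      refine h3.congr_of_eventuallyEq ?_
      have : ∀ᶠ h : ℝ in 𝓝 0, |y + h - c.im| < r := by
        apply (by fun_prop : Continuous fun h : ℝ => |y + h - c.im|).continuousAt.eventually_lt
          continuousAt_const
        simpa using h2
      filter_upwards [this] with h hh
      rw [hfe _ _ h1 hh]
      congr 1
      push_cast
      ring
  have hbs : ∀ w ∈ Metric.ball c r, |w.re - c.re| < r ∧ |w.im - c.im| < r := by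
    intro w hw
    rw [Metric.mem_ball, dist_eq_norm] at hw
    have h1 := Complex.abs_re_le_norm (w - c)
    have h2 := Complex.abs_im_le_norm (w - c)
    simp only [Complex.sub_re, Complex.sub_im] at h1 h2
    exact ⟨by linarith, by linarith⟩
  have hzero : ∀ x0 x1 y0 y1 : ℝ, |x0 - c.re| < r → |x1 - c.re| < r → |y0 - c.im| < r →
      |y1 - c.im| < r → x0 ≤ x1 → y0 ≤ y1 → gmA f x0 x1 y0 y1 = 0 := by
    intro x0 x1 y0 y1 a1 a2 a3 a4 hx hy
    apply gm_zero hfc _ _ _ _ hx hy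
    rintro ⟨x, y⟩ ⟨⟨h1, h2⟩, h3, h4⟩
    simp only at h1 h2 h3 h4
    rw [abs_lt] at a1 a2 a3 a4
    exact hder x y (by rw [abs_lt]; constructor <;> linarith)
      (by rw [abs_lt]; constructor <;> linarith)
  have hzero2 : ∀ x0 x1 y0 y1 : ℝ, |x0 - c.re| < r → |x1 - c.re| < r → |y0 - c.im| < r →
      |y1 - c.im| < r → gmA f x0 x1 y0 y1 = 0 := by
    intro x0 x1 y0 y1 a1 a2 a3 a4
    rcases le_total x0 x1 with hx | hx <;> rcases le_total y0 y1 with hy | hy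
    · exact hzero _ _ _ _ a1 a2 a3 a4 hx hy
    · rw [gmA_swapy, hzero _ _ _ _ a1 a2 a4 a3 hx hy, neg_zero]
    · rw [gmA_swapx, hzero _ _ _ _ a2 a1 a3 a4 hx hy, neg_zero]
    · rw [gmA_swapx, gmA_swapy, hzero _ _ _ _ a2 a1 a4 a3 hx hy, neg_zero, neg_zero]
  have hcons : Complex.IsConservativeOn G (Metric.ball c r) := by
    intro z w hzw
    have hz : z ∈ Metric.ball c r := hzw (by simp [Complex.Rectangle, Complex.mem_reProdIm])
    have hw : w ∈ Metric.ball c r := hzw (by simp [Complex.Rectangle, Complex.mem_reProdIm])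
    obtain ⟨z1, z2⟩ := hbs z hz
    obtain ⟨w1, w2⟩ := hbs w hw
    rw [← add_eq_zero_iff_eq_neg, Complex.wedgeIntegral_add_wedgeIntegral_eq]
    rw [← hzero2 z.re w.re z.im w.im z1 w1 z2 w2]
    have hu : ∀ {p q s m : ℝ}, |p - m| < r → |q - m| < r → s ∈ uIcc p q → |s - m| < r := by
      intro p q s m h1 h2 h3
      rw [mem_uIcc] at h3
      rw [abs_lt] at *
      rcases h3 with h3 | h3 <;> constructor <;> linarith [h3.1, h3.2]
    unfold gmA
    simp only [smul_eq_mul]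
    congr 1
    · congr 1
      · congr 1
        · exact intervalIntegral.integral_congr fun s hs => (hfe _ _ (hu z1 w1 hs) z2).symm
        · exact intervalIntegral.integral_congr fun s hs => (hfe _ _ (hu z1 w1 hs) w2).symm
      · congr 1
        exact intervalIntegral.integral_congr fun s hs => (hfe _ _ w1 (hu z2 w2 hs)).symm
    · congr 1
      exact intervalIntegral.integral_congr fun s hs => (hfe _ _ z1 (hu z2 w2 hs)).symm
  have hGb : ContinuousOn G (Metric.ball c r) :=
    hG.mono fun w hw => hsq w (hbs w hw).1.le (hbs w hw).2.le
  have := (Complex.isConservativeOn_and_continuousOn_iff_isDifferentiableOn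
    Metric.isOpen_ball).1 ⟨hcons, hGb⟩
  exact (this.differentiableAt (Metric.ball_mem_nhds c hr0)).differentiableWithinAt

theorem xi_lin (a b : ℂ) (p h : ℝ × ℝ × ℝ) (t : ℝ) :
    xi a b (p + t • h) = xi a b p + t * xi a b h := by
  simp only [xi, Prod.fst_add, Prod.snd_add, Prod.smul_fst, Prod.smul_snd, smul_eq_mul]
  push_cast
  ring

theorem xi_sec (a b : ℂ) (hab : a.im ≠ 0 ∨ b.im ≠ 0) :
    ∃ s : ℂ → ℝ × ℝ × ℝ, Continuous s ∧ (∀ w, xi a b (s w) = w) ∧ s 0 = 0 ∧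
      ∀ (v w : ℂ) (t : ℝ), s (v + t * w) = s v + t • s w := by
  rcases hab with h | h
  · refine ⟨fun w => (w.re - w.im / a.im * a.re, w.im / a.im, 0), by fun_prop, ?_, by simp, ?_⟩
    · intro w
      apply Complex.ext
      · simp [xi]
      · simp [xi]; field_simp
    · intro v w t
      ext <;> simp <;> ring
  · refine ⟨fun w => (w.re - w.im / b.im * b.re, 0, w.im / b.im), by fun_prop, ?_, by simp, ?_⟩
    · intro w
      apply Complex.ext
      · simp [xi]
      · simp [xi]; field_simp
    · intro v w t
      ext <;> simp <;> ring

theorem gm_scalar (a b : ℂ) (hab : a.im ≠ 0 ∨ b.im ≠ 0) (Ω : Set (ℝ × ℝ × ℝ)) (hΩ : IsOpen Ω)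
    (hconv : ConvexInDirection Ω (lineL a b)) (U : ℝ × ℝ × ℝ → ℂ) (hU : ContinuousOn U Ω)
    (hd : ∀ p ∈ Ω, ∃ D : ℂ, ∀ h : ℝ × ℝ × ℝ,
      Tendsto (fun ε : ℝ => (ε : ℂ)⁻¹ * (U (p + ε • h) - U p)) (𝓝[>] 0) (𝓝 (D * xi a b h))) :
    ∃ F : ℂ → ℂ, AnalyticOnNhd ℂ F (xi a b '' Ω) ∧ ∀ p ∈ Ω, U p = F (xi a b p) := by
  classical
  have hfib : ∀ p ∈ Ω, ∀ q ∈ Ω, xi a b p = xi a b q → U p = U q := by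
    intro p hp q hq hpq
    have hxi : xi a b (q - p) = 0 := by
      have := xi_lin a b p (q - p) 1
      simp only [one_smul, add_sub_cancel, hpq, Complex.ofReal_one, one_mul] at this
      exact (left_eq_add.1 this)
    have hL : q - p ∈ lineL a b := by
      have h1 := congrArg Complex.re hxi
      have h2 := congrArg Complex.im hxi
      simp [xi] at h1 h2
      exact ⟨by simpa using h1, by simpa using h2⟩
    have hseg := hconv p hp q hq hL
    have hmem : ∀ t ∈ Icc (0 : ℝ) 1, p + t • (q - p) ∈ Ω := by
      intro t ht
      apply hseg
      rw [segment_eq_image']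
      exact ⟨t, ht, rfl⟩
    have hc := constant_of_has_deriv_right_zero (f := fun t : ℝ => U (p + t • (q - p)))
      (a := 0) (b := 1) (hU.comp (by fun_prop) hmem) ?_ 1 (by simp)
    · simpa using hc.symm
    · intro t ht
      obtain ⟨D, hD⟩ := hd _ (hmem t ⟨ht.1, ht.2.le⟩)
      have h1 := hD (q - p)
      rw [hxi, mul_zero] at h1
      rw [← hasDerivWithinAt_Ioi_iff_Ici, hasDerivWithinAt_iff_tendsto_slope' (by simp)]
      have h2 : Tendsto (fun x : ℝ => x - t) (𝓝[>] t) (𝓝[>] 0) := by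
        apply tendsto_nhdsWithin_of_tendsto_nhds_of_eventually_within
        · have : Tendsto (fun x : ℝ => x - t) (𝓝 t) (𝓝 (t - t)) := by
            apply Continuous.tendsto; fun_prop
          rw [sub_self] at this
          exact this.mono_left nhdsWithin_le_nhds
        · filter_upwards [self_mem_nhdsWithin] with x hx
          simpa using hx
      refine (h1.comp h2).congr ?_
      intro x
      simp only [Function.comp, slope, vsub_eq_sub, Complex.real_smul, Complex.ofReal_inv]
      congr 3
      rw [add_assoc, ← add_smul, add_sub_cancel]
  let F : ℂ → ℂ := fun w => if h : ∃ p ∈ Ω, xi a b p = w then U h.choose else 0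
  have hF : ∀ p ∈ Ω, U p = F (xi a b p) := by
    intro p hp
    have h : ∃ q ∈ Ω, xi a b q = xi a b p := ⟨p, hp, rfl⟩
    simp only [F, dif_pos h]
    exact hfib p hp _ h.choose_spec.1 h.choose_spec.2.symm
  refine ⟨F, ?_, hF⟩
  rintro _ ⟨p, hp, rfl⟩
  obtain ⟨s, hs, hxs, hs0, hsl⟩ := xi_sec a b hab
  set w0 := xi a b p with hw0
  have hg : Continuous fun w : ℂ => p + s (w - w0) := by fun_prop
  set V : Set ℂ := (fun w : ℂ => p + s (w - w0)) ⁻¹' Ω with hVdef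
  have hV : IsOpen V := hΩ.preimage hg
  have hw0V : w0 ∈ V := by simp [hVdef, hs0, hp]
  have hFV : ∀ w ∈ V, F w = U (p + s (w - w0)) := by
    intro w hw
    rw [hF _ hw]
    congr 1
    have := xi_lin a b p (s (w - w0)) 1
    simp only [one_smul, hxs, Complex.ofReal_one, one_mul] at this
    rw [this]; simp [hw0]
  have hdiff : DifferentiableOn ℂ (fun w => U (p + s (w - w0))) V := by
    apply gm_holo hV
    · exact hU.comp hg.continuousOn fun w hw => hw
    · intro w hw
      obtain ⟨D, hD⟩ := hd _ hw
      refine ⟨D, fun h => ?_⟩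
      have h1 := hD (s h)
      rw [hxs] at h1
      refine h1.congr ?_
      intro ε
      congr 3
      rw [add_assoc, ← hsl]
      congr 3
      ring_nf
  have := (hdiff.congr hFV).analyticAt (hV.mem_nhds hw0V)
  exact this

theorem gm_re (a : ℂ) (h : a ∉ Set.range ((↑) : ℝ → ℂ)) : a.im ≠ 0 := by
  intro h0
  exact h ⟨a.re, by apply Complex.ext <;> simp [h0]⟩

theorem HC_cont : Continuous (fun q : HC => (q.re, q.imI, q.imJ, q.imK)) :=
  continuous_induced_dom

theorem c1_cont : Continuous c1 := by
  have h : Continuous fun r : ℂ × ℂ × ℂ × ℂ => r.1 - Complex.I * r.2.1 := by fun_prop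
  exact h.comp HC_cont

theorem c2_cont : Continuous c2 := by
  have h : Continuous fun r : ℂ × ℂ × ℂ × ℂ => r.1 + Complex.I * r.2.1 := by fun_prop
  exact h.comp HC_cont

theorem c3_cont : Continuous c3 := by
  have h : Continuous fun r : ℂ × ℂ × ℂ × ℂ => -(Complex.I * r.2.2.1) - r.2.2.2 := by fun_prop
  exact h.comp HC_cont

theorem c4_cont : Continuous c4 := by
  have h : Continuous fun r : ℂ × ℂ × ℂ × ℂ => -(Complex.I * r.2.2.1) + r.2.2.2 := by fun_prop
  exact h.comp HC_cont

theorem HC_decomp (a : HC) : a = c1 a • e1 + c2 a • e2 + c3 a • e3 + c4 a • e4 := by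
  have hI := Complex.I_sq
  ext <;> simp [c1, c2, c3, c4, e1, e2, e3, e4] <;> ring_nf <;> simp [hI]

theorem zeta_lin (i2 i3 : HC) (p h : ℝ × ℝ × ℝ) (t : ℝ) :
    zeta i2 i3 (p + t • h) = zeta i2 i3 p + (t : ℂ) • zeta i2 i3 h := by
  ext <;> simp [zeta] <;> ring

theorem zeta_cont (i2 i3 : HC) : Continuous (zeta i2 i3) := by
  rw [continuous_induced_rng]
  simp only [Function.comp_def, zeta]
  simp only [QuaternionAlgebra.re_add, QuaternionAlgebra.re_smul, QuaternionAlgebra.imI_add,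
    QuaternionAlgebra.imI_smul, QuaternionAlgebra.imJ_add, QuaternionAlgebra.imJ_smul,
    QuaternionAlgebra.imK_add, QuaternionAlgebra.imK_smul, smul_eq_mul]
  fun_prop

theorem gm_coord (c : HC → ℂ) (hc : Continuous c)
    (hcl : ∀ (t : ℂ) (u v : HC), c (t • (u - v)) = t * (c u - c v))
    (a b : ℂ) (hab : a ∉ Set.range ((↑) : ℝ → ℂ) ∨ b ∉ Set.range ((↑) : ℝ → ℂ))
    (i2 i3 : HC) (Ω : Set (ℝ × ℝ × ℝ)) (hΩ : IsOpen Ω)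
    (hcm : ∀ (u : HC) (h : ℝ × ℝ × ℝ), c (u * zeta i2 i3 h) = c u * xi a b h)
    (hconv : ConvexInDirection Ω (lineL a b))
    (Φh : HC → HC) (hΦh : LeftGMonogenic i2 i3 Φh (zeta i2 i3 '' Ω)) :
    ∃ F : ℂ → ℂ, AnalyticOnNhd ℂ F (xi a b '' Ω) ∧
      ∀ p ∈ Ω, c (Φh (zeta i2 i3 p)) = F (xi a b p) := by
  refine gm_scalar a b (hab.imp (gm_re a) (gm_re b)) Ω hΩ hconv
    (fun p => c (Φh (zeta i2 i3 p))) ?_ ?_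
  · exact hc.comp_continuousOn (hΦh.1.comp (zeta_cont i2 i3).continuousOn (mapsTo_image _ _))
  · intro p hp
    obtain ⟨D, hD⟩ := hΦh.2 _ (mem_image_of_mem _ hp)
    refine ⟨c D, fun h => ?_⟩
    have h1 := (hc.tendsto _).comp (hD (zeta i2 i3 h) ⟨h, rfl⟩)
    rw [hcm] at h1
    refine h1.congr ?_
    intro ε
    simp only [Function.comp, hcl, zeta_lin]

theorem f1_zeta (a₁ a₂ b₁ b₂ : ℂ) (p : ℝ × ℝ × ℝ) :
    f1 (zeta (a₁ • e1 + a₂ • e2) (b₁ • e1 + b₂ • e2) p) = xi a₁ b₁ p := by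
  have hI := Complex.I_sq
  simp [f1, zeta, c1, c3, e1, e2, xi]
  ring_nf
  simp [hI]
  try ring

theorem f2_zeta (a₁ a₂ b₁ b₂ : ℂ) (p : ℝ × ℝ × ℝ) :
    f2 (zeta (a₁ • e1 + a₂ • e2) (b₁ • e1 + b₂ • e2) p) = xi a₂ b₂ p := by
  have hI := Complex.I_sq
  simp [f2, zeta, c2, c4, e1, e2, xi]
  ring_nf
  simp [hI]
  try ring

theorem zeta_form (a₁ a₂ b₁ b₂ : ℂ) (p : ℝ × ℝ × ℝ) :
    zeta (a₁ • e1 + a₂ • e2) (b₁ • e1 + b₂ • e2) p = xi a₁ b₁ p • e1 + xi a₂ b₂ p • e2 := by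
  ext <;> simp [zeta, e1, e2, xi] <;> ring

theorem c_mul (u : HC) (s t : ℂ) :
    c1 (u * (s • e1 + t • e2)) = c1 u * s ∧ c2 (u * (s • e1 + t • e2)) = c2 u * t ∧
    c3 (u * (s • e1 + t • e2)) = c3 u * t ∧ c4 (u * (s • e1 + t • e2)) = c4 u * s := by
  have hI := Complex.I_mul_I
  refine ⟨?_, ?_, ?_, ?_⟩ <;> simp [c1, c2, c3, c4, e1, e2]
  · linear_combination (-(s - t) * u.re / 2) * hI
  · linear_combination ((s - t) * u.re / 2) * hI
  · linear_combination (-(s - t) * u.imK / 2) * hI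
  · linear_combination (-(s - t) * u.imK / 2) * hI

/-- Theorem 6: on a domain convex in the directions of `L₁` and `L₂`, every
left-G-monogenic map has the form `F₁(ξ₁)e₁ + F₂(ξ₂)e₂ + F₃(ξ₂)e₃ + F₄(ξ₁)e₄` with `F₁, F₄`
analytic on `D₁ = f₁(Ω_ζ)` and `F₂, F₃` analytic on `D₂ = f₂(Ω_ζ)`. -/
theorem statement13 (a₁ a₂ b₁ b₂ : ℂ) (i2 i3 : HC)
    (hi2 : i2 = a₁ • e1 + a₂ • e2) (hi3 : i3 = b₁ • e1 + b₂ • e2)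
    (hLI : LinIndep i2 i3)
    (Ω : Set (ℝ × ℝ × ℝ)) (hΩo : IsOpen Ω) (hΩc : IsConnected Ω)
    (hconv1 : ConvexInDirection Ω (lineL a₁ b₁)) (hconv2 : ConvexInDirection Ω (lineL a₂ b₂))
    (hab1 : a₁ ∉ Set.range ((↑) : ℝ → ℂ) ∨ b₁ ∉ Set.range ((↑) : ℝ → ℂ))
    (hab2 : a₂ ∉ Set.range ((↑) : ℝ → ℂ) ∨ b₂ ∉ Set.range ((↑) : ℝ → ℂ))
    (Φh : HC → HC) (hΦh : LeftGMonogenic i2 i3 Φh (zeta i2 i3 '' Ω)) :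
    ∃ F1 F2 F3 F4 : ℂ → ℂ,
      AnalyticOnNhd ℂ F1 (f1 '' (zeta i2 i3 '' Ω)) ∧
      AnalyticOnNhd ℂ F4 (f1 '' (zeta i2 i3 '' Ω)) ∧
      AnalyticOnNhd ℂ F2 (f2 '' (zeta i2 i3 '' Ω)) ∧
      AnalyticOnNhd ℂ F3 (f2 '' (zeta i2 i3 '' Ω)) ∧
      ∀ p ∈ Ω, Φh (zeta i2 i3 p) =
        F1 (xi a₁ b₁ p) • e1 + F2 (xi a₂ b₂ p) • e2 +
        F3 (xi a₂ b₂ p) • e3 + F4 (xi a₁ b₁ p) • e4 := by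
  subst hi2 hi3
  have hD1 : f1 '' (zeta (a₁ • e1 + a₂ • e2) (b₁ • e1 + b₂ • e2) '' Ω) = xi a₁ b₁ '' Ω := by
    rw [image_image]
    exact image_congr fun p _ => f1_zeta a₁ a₂ b₁ b₂ p
  have hD2 : f2 '' (zeta (a₁ • e1 + a₂ • e2) (b₁ • e1 + b₂ • e2) '' Ω) = xi a₂ b₂ '' Ω := by
    rw [image_image]
    exact image_congr fun p _ => f2_zeta a₁ a₂ b₁ b₂ p
  rw [hD1, hD2]
  obtain ⟨F1, A1, E1⟩ := gm_coord c1 c1_cont (by intro t u v; simp [c1]; ring) a₁ b₁ hab1 _ _ Ω hΩo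
    (by intro u h; rw [zeta_form]; exact (c_mul u _ _).1) hconv1 Φh hΦh
  obtain ⟨F2, A2, E2⟩ := gm_coord c2 c2_cont (by intro t u v; simp [c2]; ring) a₂ b₂ hab2 _ _ Ω hΩo
    (by intro u h; rw [zeta_form]; exact (c_mul u _ _).2.1) hconv2 Φh hΦh
  obtain ⟨F3, A3, E3⟩ := gm_coord c3 c3_cont (by intro t u v; simp [c3]; ring) a₂ b₂ hab2 _ _ Ω hΩo
    (by intro u h; rw [zeta_form]; exact (c_mul u _ _).2.2.1) hconv2 Φh hΦh
  obtain ⟨F4, A4, E4⟩ := gm_coord c4 c4_cont (by intro t u v; simp [c4]; ring) a₁ b₁ hab1 _ _ Ω hΩo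
    (by intro u h; rw [zeta_form]; exact (c_mul u _ _).2.2.2) hconv1 Φh hΦh
  refine ⟨F1, F2, F3, F4, A1, A4, A2, A3, fun p hp => ?_⟩
  rw [← E1 p hp, ← E2 p hp, ← E3 p hp, ← E4 p hp]
  exact HC_decomp _

end
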